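/- Let d ≥ 2 and r > d. There exist ε_* > 0 and C > 0, independent of T, such that for every ε ∈ [0, ε_*] and every T ∈ (0,∞), the solution m* of the damped/driven wave kinetic equation with zero data at τ = −T converges exponentially to the steady state m^ε: ‖m*(τ) − m^ε‖_r ≤ C ‖m^ε‖_r e^{−(τ+T)} for all τ ≥ −T, where m^ε is the unique steady state in C_r(ℝ^d) near m^0(s) = b(s)²/γ_s, i.e. the unique y close to m^0 with −2γ_s y(s) + 2b(s)² + ε K_s(y) = 0 for all s. -/

import Mathlib

open MeasureTheory

noncomputable section

/-- `ℝ^d` with its Euclidean structure. -/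
abbrev Rd (d : ℕ) := EuclideanSpace ℝ (Fin d)

/-- Integral of `f` over the hyperplane `x^⊥ = {z : x·z = 0}` with respect to the
`(d-1)`-dimensional Lebesgue measure induced by the Euclidean inner product. -/
noncomputable def hyperplaneIntegral (d : ℕ) (x : Rd d) (f : Rd d → ℝ) : ℝ :=
  ∫ z : ((ℝ ∙ x)ᗮ : Submodule ℝ (Rd d)), f (z : Rd d)

/-- The weighted sup-norm `‖y‖_r = sup_s (1+|s|)^r |y(s)|`. -/
noncomputable def wNorm (d : ℕ) (r : ℝ) (y : Rd d → ℝ) : ℝ :=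
  ⨆ s : Rd d, (1 + ‖s‖) ^ r * |y s|

/-- Membership in the space `C_r(ℝ^d)` of continuous functions with finite `‖·‖_r`. -/
def memCr (d : ℕ) (r : ℝ) (y : Rd d → ℝ) : Prop :=
  Continuous y ∧ ∃ K : ℝ, ∀ s : Rd d, (1 + ‖s‖) ^ r * |y s| ≤ K

/-- The integrand of the wave kinetic integral. -/
noncomputable def kinIntegrand (d : ℕ) (y : Rd d → ℝ) (s x z : Rd d) : ℝ :=
  y (s + x) * y (s + z) * y (s + x + z) + y (s + x) * y (s + z) * y s
    - y (s + z) * y (s + x + z) * y s - y (s + x) * y (s + x + z) * y s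

/-- The wave kinetic integral
`K_s(y) = 2π ∫_{ℝ^d} |x|⁻¹ (∫_{x^⊥} [...] dz) dx`. -/
noncomputable def Kwk (d : ℕ) (y : Rd d → ℝ) (s : Rd d) : ℝ :=
  2 * Real.pi * ∫ x : Rd d, ‖x‖⁻¹ * hyperplaneIntegral d x (kinIntegrand d y s x)

/-- `γ_s = (1+|s|²)^{r_*}`. -/
noncomputable def gam (d : ℕ) (rstar : ℝ) (s : Rd d) : ℝ := (1 + ‖s‖ ^ 2) ^ rstar

/-- A (bounded continuous, mild-form) solution of the damped/driven wave kinetic equation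
`ṁ_s = −2γ_s m_s + 2 b_s² + ε K_s(m)` with zero data at `τ = −T`:
a curve `m : [−T,∞) → C_r(ℝ^d)` which is bounded, continuous in the `‖·‖_r`-norm, and
satisfies `m_s(τ) = ∫_{−T}^τ e^{−2γ_s(τ−l)} (2 b(s)² + ε K_s(m(l))) dl`. -/
def IsWKESol (d : ℕ) (r rstar : ℝ) (b : Rd d → ℝ) (T ε : ℝ)
    (m : ℝ → Rd d → ℝ) : Prop :=
  (∀ τ ∈ Set.Ici (-T), memCr d r (m τ)) ∧
  (∃ K : ℝ, ∀ τ ∈ Set.Ici (-T), wNorm d r (m τ) ≤ K) ∧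
  (∀ τ₀ ∈ Set.Ici (-T), ∀ δ : ℝ, 0 < δ → ∃ η : ℝ, 0 < η ∧ ∀ τ ∈ Set.Ici (-T),
      |τ - τ₀| < η → wNorm d r (fun s => m τ s - m τ₀ s) < δ) ∧
  (∀ τ ∈ Set.Ici (-T), ∀ s : Rd d,
      m τ s = ∫ l in Set.Icc (-T) τ,
        Real.exp (-2 * gam d rstar s * (τ - l)) * (2 * (b s) ^ 2 + ε * Kwk d (m l) s))

/-- A steady state of the damped/driven wave kinetic equation:
`−2γ_s y(s) + 2b(s)² + ε K_s(y) = 0` for all `s`, with `y ∈ C_r(ℝ^d)`. -/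
def IsSteadyState (d : ℕ) (r rstar : ℝ) (b : Rd d → ℝ) (ε : ℝ) (y : Rd d → ℝ) : Prop :=
  memCr d r y ∧
  ∀ s : Rd d, -2 * gam d rstar s * y s + 2 * (b s) ^ 2 + ε * Kwk d y s = 0

open Set Filter Topology

/-- The decay profile `(1+‖a‖)^{-r}`. -/
def decay {E : Type*} [Norm E] (r : ℝ) (a : E) : ℝ := (1 + ‖a‖) ^ (-r)

section Decay

variable {E F : Type*} [SeminormedAddCommGroup E] [SeminormedAddCommGroup F] {r : ℝ}

lemma decay_pos (r : ℝ) (a : E) : 0 < decay r a := by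
  unfold decay; positivity

lemma decay_le_one (hr : 0 ≤ r) (a : E) : decay r a ≤ 1 :=
  Real.rpow_le_one_of_one_le_of_nonpos (by linarith [norm_nonneg a]) (by linarith)

lemma rpow_mul_decay (r : ℝ) (a : E) : (1 + ‖a‖) ^ r * decay r a = 1 := by
  have h : (0 : ℝ) < 1 + ‖a‖ := by positivity
  rw [decay, ← Real.rpow_add h, add_neg_cancel, Real.rpow_zero]

lemma continuous_decay (r : ℝ) : Continuous (decay r : E → ℝ) := by
  unfold decay
  exact (continuous_const.add continuous_norm).rpow_const
    (fun a => Or.inl (add_pos_of_pos_of_nonneg one_pos (norm_nonneg a)).ne')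

lemma decay_le_of_norm_le (hr : 0 ≤ r) {a : E} {c : F} (h : ‖c‖ ≤ ‖a‖) :
    decay r a ≤ decay r c :=
  Real.rpow_le_rpow_of_nonpos (by positivity) (by linarith) (by linarith)

lemma decay_le_mul_of_norm_le (hr : 0 ≤ r) {k : ℝ} (hk : 0 < k) {a : E} {c : F}
    (h : 1 + ‖c‖ ≤ k * (1 + ‖a‖)) : decay r a ≤ k ^ r * decay r c := by
  have ha : (0 : ℝ) < 1 + ‖a‖ := by positivity
  have hc : (0 : ℝ) < 1 + ‖c‖ := by positivity
  have h1 : (k * (1 + ‖a‖)) ^ (-r) ≤ decay r c :=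
    Real.rpow_le_rpow_of_nonpos hc h (by linarith)
  rw [Real.mul_rpow hk.le ha.le] at h1
  calc decay r a = k ^ r * (k ^ (-r) * decay r a) := by
        rw [← mul_assoc, ← Real.rpow_add hk, add_neg_cancel, Real.rpow_zero, one_mul]
    _ ≤ k ^ r * decay r c := by unfold decay at *; gcongr

lemma decay_le_of_dist_le_one (hr : 0 ≤ r) {a c : E} (h : ‖c - a‖ ≤ 1) :
    decay r a ≤ 2 ^ r * decay r c := by
  apply decay_le_mul_of_norm_le hr two_pos
  have := norm_add_le (c - a) a
  rw [sub_add_cancel] at this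
  linarith [norm_nonneg a]

lemma decay_mul_decay_le (hr : 0 ≤ r) {a c x : E} {u : F} (hx : x = c - a)
    (ha : ‖u‖ ≤ ‖a‖) (hc : ‖u‖ ≤ ‖c‖) :
    decay r a * decay r c ≤ 2 ^ r * decay r x * decay r u := by
  have hn : ‖x‖ ≤ ‖c‖ + ‖a‖ := hx ▸ norm_sub_le c a
  have h1 := decay_pos r a
  have h2 := decay_pos r c
  have h0 : 0 ≤ 2 ^ r * decay r x := mul_nonneg (by positivity) (decay_pos r x).le
  rcases le_total ‖a‖ ‖c‖ with h | h
  · have h3 : decay r c ≤ 2 ^ r * decay r x :=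
      decay_le_mul_of_norm_le hr two_pos (by linarith [norm_nonneg c])
    have h4 := decay_le_of_norm_le hr ha
    rw [mul_comm]
    gcongr
  · have h3 : decay r a ≤ 2 ^ r * decay r x :=
      decay_le_mul_of_norm_le hr two_pos (by linarith [norm_nonneg c])
    have h4 := decay_le_of_norm_le hr hc
    gcongr

/-- If `s = a + c - e` then a product of three profiles is controlled by the profile at `s`. -/
lemma decay_triple_le (hr : 0 ≤ r) {s a c e : E} (hs : s = a + c - e) :
    decay r a * decay r c * decay r e ≤
      3 ^ r * decay r s *
        (decay r a * decay r c + decay r c * decay r e + decay r a * decay r e) := by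
  have hn : ‖s‖ ≤ ‖a‖ + ‖c‖ + ‖e‖ := by
    rw [hs]; exact (norm_sub_le _ _).trans (by gcongr; exact norm_add_le _ _)
  have ha := decay_pos r a
  have hc := decay_pos r c
  have he := decay_pos r e
  have hs' := decay_pos r s
  have h3 : (0 : ℝ) < 3 ^ r := by positivity
  have key : decay r a ≤ 3 ^ r * decay r s ∨ decay r c ≤ 3 ^ r * decay r s ∨
      decay r e ≤ 3 ^ r * decay r s := by
    by_cases h1 : ‖s‖ ≤ 3 * ‖a‖
    · exact Or.inl (decay_le_mul_of_norm_le hr three_pos (by linarith))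
    by_cases h2 : ‖s‖ ≤ 3 * ‖c‖
    · exact Or.inr (Or.inl (decay_le_mul_of_norm_le hr three_pos (by linarith)))
    · exact Or.inr (Or.inr (decay_le_mul_of_norm_le hr three_pos (by linarith)))
  have p1 := mul_pos ha hc
  have p2 := mul_pos hc he
  have p3 := mul_pos ha he
  have q := mul_pos h3 hs'
  rcases key with h | h | h
  · calc _ = decay r a * (decay r c * decay r e) := by ring
      _ ≤ 3 ^ r * decay r s * (decay r c * decay r e) := by gcongr
      _ ≤ _ := by gcongr; linarith
  · calc _ = decay r c * (decay r a * decay r e) := by ring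
      _ ≤ 3 ^ r * decay r s * (decay r a * decay r e) := by gcongr
      _ ≤ _ := by gcongr; linarith
  · calc _ = decay r e * (decay r a * decay r c) := by ring
      _ ≤ 3 ^ r * decay r s * (decay r a * decay r c) := by gcongr
      _ ≤ _ := by gcongr; linarith

end Decay

section Reflection

variable {d : ℕ}

/-- An isometry of `ℝ^d` exchanging `x` and `‖x‖ e`, hence mapping `e^⊥` onto `x^⊥`. -/
def hyperRefl (e x : Rd d) : Rd d ≃ₗᵢ[ℝ] Rd d := (ℝ ∙ (x - ‖x‖ • e))ᗮ.reflection

lemma hyperRefl_hyperRefl (e x z : Rd d) : hyperRefl e x (hyperRefl e x z) = z :=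
  Submodule.reflection_reflection _ _

lemma hyperRefl_self {e : Rd d} (he : ‖e‖ = 1) (x : Rd d) : hyperRefl e x x = ‖x‖ • e :=
  Submodule.reflection_sub (by rw [norm_smul, he, norm_norm, mul_one])

lemma measurable_hyperRefl (e : Rd d) :
    Measurable (fun p : Rd d × (ℝ ∙ e)ᗮ => hyperRefl e p.1 (p.2 : Rd d)) := by
  have h : ∀ p : Rd d × (ℝ ∙ e)ᗮ, hyperRefl e p.1 (p.2 : Rd d) =
      -((2 : ℝ) • ((inner ℝ (p.1 - ‖p.1‖ • e) (p.2 : Rd d)) / ‖p.1 - ‖p.1‖ • e‖ ^ 2) •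
        (p.1 - ‖p.1‖ • e) - (p.2 : Rd d)) := by
    intro p
    rw [hyperRefl, Submodule.reflection_orthogonal_apply, Submodule.reflection_singleton_apply]
    norm_num [two_smul]
  simp_rw [h]
  have h2 : Measurable (fun p : Rd d × (ℝ ∙ e)ᗮ => (p.2 : Rd d)) :=
    measurable_subtype_coe.comp measurable_snd
  have h1 : Measurable (fun p : Rd d × (ℝ ∙ e)ᗮ => p.1 - ‖p.1‖ • e) := by fun_prop
  exact (((((h1.inner h2).div (h1.norm.pow_const 2)).smul h1).const_smul (2 : ℝ)).sub h2).neg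

lemma integral_submodule_congr {K L : Submodule ℝ (Rd d)} (h : K = L) (f : Rd d → ℝ) :
    ∫ z : K, f z = ∫ z : L, f z := by
  subst h; rfl

lemma hyperplaneIntegral_eq {e x : Rd d} (he : ‖e‖ = 1) (hx : x ≠ 0) (f : Rd d → ℝ) :
    hyperplaneIntegral d x f = ∫ z : (ℝ ∙ e)ᗮ, f (hyperRefl e x z) := by
  have hxe : hyperRefl e x e = ‖x‖⁻¹ • x := by
    have h := congrArg (hyperRefl e x) (hyperRefl_self he x)
    rw [hyperRefl_hyperRefl, map_smul] at h
    calc hyperRefl e x e = ‖x‖⁻¹ • (‖x‖ • hyperRefl e x e) := by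
          rw [smul_smul, inv_mul_cancel₀ (norm_ne_zero_iff.mpr hx), one_smul]
      _ = ‖x‖⁻¹ • x := by rw [← h]
  have hspan : (ℝ ∙ e)ᗮ.map ((hyperRefl e x).toLinearEquiv : Rd d →ₗ[ℝ] Rd d) = (ℝ ∙ x)ᗮ := by
    rw [Submodule.map_orthogonal_equiv, Submodule.map_span]
    congr 1
    simp only [image_singleton]
    change Submodule.span ℝ {hyperRefl e x e} = _
    rw [hxe]
    exact Submodule.span_singleton_smul_eq
      (IsUnit.mk0 _ (inv_ne_zero (norm_ne_zero_iff.mpr hx))) x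
  have hmp := ((hyperRefl e x).submoduleMap (ℝ ∙ e)ᗮ).measurePreserving
  have := hmp.integral_comp ((hyperRefl e x).submoduleMap
    (ℝ ∙ e)ᗮ).toHomeomorph.measurableEmbedding (fun z => f z)
  exact (integral_submodule_congr hspan.symm f).trans this.symm

end Reflection

section Core

variable {d : ℕ} {r : ℝ}

/-- The dominating function for the wave kinetic integrand. -/
def kinCore (r : ℝ) (e s : Rd d) (p : Rd d × (ℝ ∙ e)ᗮ) : ℝ :=
  ‖p.1‖⁻¹ * (decay r (s + p.1) * decay r (s + hyperRefl e p.1 p.2)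
    + decay r (s + hyperRefl e p.1 p.2) * decay r (s + p.1 + hyperRefl e p.1 p.2)
    + decay r (s + p.1) * decay r (s + p.1 + hyperRefl e p.1 p.2))

lemma kinCore_nonneg (e s : Rd d) (p : Rd d × (ℝ ∙ e)ᗮ) : 0 ≤ kinCore r e s p := by
  have h1 := (decay_pos r (s + p.1)).le
  have h2 := (decay_pos r (s + hyperRefl e p.1 p.2)).le
  have h3 := (decay_pos r (s + p.1 + hyperRefl e p.1 p.2)).le
  unfold kinCore
  positivity

lemma measurable_kinCore (e s : Rd d) : Measurable (kinCore r e s) := by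
  have hw := (continuous_decay r : Continuous (decay r : Rd d → ℝ)).measurable
  have hR := measurable_hyperRefl e
  have h1 := hw.comp (measurable_fst.const_add s : Measurable
    (fun p : Rd d × (ℝ ∙ e)ᗮ => s + p.1))
  have h2 := hw.comp (hR.const_add s)
  have h3 := hw.comp ((measurable_fst.const_add s).add hR)
  exact measurable_fst.norm.inv.mul (((h1.mul h2).add (h2.mul h3)).add (h1.mul h3))

lemma inv_norm_mul_decay_le (hr : 0 ≤ r) (s x : Rd d) :
    ‖x‖⁻¹ * decay r (s + x) ≤ 2 ^ r * (‖x‖⁻¹ * decay r x) + decay r (s + x) := by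
  have h1 := decay_pos r (s + x)
  have h2 := decay_pos r x
  have h3 : 0 ≤ ‖x‖⁻¹ := by positivity
  rcases le_total ‖x‖ 1 with h | h
  · have h4 : decay r (s + x) ≤ 2 ^ r * decay r x :=
      decay_le_mul_of_norm_le hr two_pos (by linarith [norm_nonneg (s + x)])
    calc ‖x‖⁻¹ * decay r (s + x) ≤ ‖x‖⁻¹ * (2 ^ r * decay r x) := by gcongr
      _ ≤ _ := by linarith
  · have h4 : ‖x‖⁻¹ ≤ 1 := inv_le_one_of_one_le₀ h
    have h5 : ‖x‖⁻¹ * decay r (s + x) ≤ 1 * decay r (s + x) := by gcongr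
    have h6 : 0 ≤ (2 : ℝ) ^ r * (‖x‖⁻¹ * decay r x) := by positivity
    linarith

lemma norm_orthogonalProjection_add_le {e : Rd d} (a : Rd d) (z : (ℝ ∙ e)ᗮ) :
    ‖(ℝ ∙ e)ᗮ.orthogonalProjectionOnto a + z‖ ≤ ‖a + z‖ := by
  have h := Submodule.norm_orthogonalProjectionOnto_apply_le (ℝ ∙ e)ᗮ (a + (z : Rd d))
  rwa [map_add, Submodule.orthogonalProjectionOnto_mem_subspace_eq_self] at h

lemma kinCore_le (hr : 0 ≤ r) {e : Rd d} (he : ‖e‖ = 1) (s : Rd d)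
    (p : Rd d × (ℝ ∙ e)ᗮ) :
    kinCore r e s p ≤
      (3 * 2 ^ r * (‖p.1‖⁻¹ * decay r p.1) + 2 * decay r (s + p.1)) *
        decay r ((ℝ ∙ e)ᗮ.orthogonalProjectionOnto (hyperRefl e p.1 s) + p.2) := by
  obtain ⟨x, z⟩ := p
  dsimp only
  set R := hyperRefl e x with hR
  set u := (ℝ ∙ e)ᗮ.orthogonalProjectionOnto (R s) + z with hu
  have hRR : ∀ y, R (R y) = y := hyperRefl_hyperRefl e x
  have n2 : ‖u‖ ≤ ‖s + R z‖ := by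
    rw [← R.norm_map (s + R z), map_add, hRR]
    exact norm_orthogonalProjection_add_le _ _
  have n3 : ‖u‖ ≤ ‖s + x + R z‖ := by
    rw [← R.norm_map (s + x + R z), map_add, hRR]
    have : u = (ℝ ∙ e)ᗮ.orthogonalProjectionOnto (R (s + x)) + z := by
      rw [hu, map_add R s x, hR, hyperRefl_self he x, map_add, map_smul]
      have : (ℝ ∙ e)ᗮ.orthogonalProjectionOnto e = 0 :=
        Submodule.orthogonalProjectionOnto_orthogonal_apply_eq_zero
          (Submodule.mem_span_singleton_self e)
      rw [this, smul_zero, add_zero]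
    rw [this]
    exact norm_orthogonalProjection_add_le _ _
  have h2 := decay_le_of_norm_le hr n2
  have h3 := decay_le_of_norm_le hr n3
  have h23 := decay_mul_decay_le (x := x) hr (by abel) n2 n3
  have p1 := decay_pos r (s + x)
  have pu := decay_pos r u
  have hx := inv_norm_mul_decay_le hr s x
  have hi : 0 ≤ ‖x‖⁻¹ := by positivity
  calc kinCore r e s (x, z)
      ≤ ‖x‖⁻¹ * (decay r (s + x) * decay r u + 2 ^ r * decay r x * decay r u
          + decay r (s + x) * decay r u) := by
        unfold kinCore
        gcongr
    _ = (2 * (‖x‖⁻¹ * decay r (s + x)) + 2 ^ r * (‖x‖⁻¹ * decay r x)) * decay r u := by ring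
    _ ≤ (2 * (2 ^ r * (‖x‖⁻¹ * decay r x) + decay r (s + x))
          + 2 ^ r * (‖x‖⁻¹ * decay r x)) * decay r u := by gcongr
    _ = _ := by ring

lemma integrable_decay (hr : (d : ℝ) < r) : Integrable (decay r : Rd d → ℝ) :=
  integrable_one_add_norm (by simpa using hr)

lemma integrable_decay_submodule (hr : (d : ℝ) < r) (K : Submodule ℝ (Rd d)) :
    Integrable (decay r : K → ℝ) := by
  refine integrable_one_add_norm (lt_of_le_of_lt ?_ hr)
  have := K.finrank_le
  rw [finrank_euclideanSpace_fin] at this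
  exact_mod_cast this

lemma integrable_inv_norm_mul_decay (hd : 2 ≤ d) (hr : (d : ℝ) < r) :
    Integrable (fun x : Rd d => ‖x‖⁻¹ * decay r x) := by
  have : Nontrivial (Rd d) := by
    have : Nonempty (Fin d) := ⟨⟨0, by omega⟩⟩
    infer_instance
  have hr0 : 0 ≤ r := (Nat.cast_nonneg d).trans hr.le
  have hw : Integrable (fun x : Rd d => (fun t : ℝ => (1 + t) ^ (-r)) ‖x‖) := integrable_decay hr
  replace hw := (integrable_fun_norm_addHaar (E := Rd d) volume
    (f := fun t : ℝ => (1 + t) ^ (-r))).mp hw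
  rw [finrank_euclideanSpace_fin] at hw
  have key : IntegrableOn (fun y : ℝ => y ^ (d - 1) • (y⁻¹ * (1 + y) ^ (-r))) (Ioi 0) := by
    have h1 : IntegrableOn (fun _ : ℝ => (1 : ℝ)) (Ioc 0 1) := by simp
    have h1' : IntegrableOn (fun y : ℝ => (Ioc (0 : ℝ) 1).indicator (fun _ => (1 : ℝ)) y)
        (Ioi 0) := (h1.integrable_indicator measurableSet_Ioc).integrableOn
    refine (h1'.add hw).mono' (by fun_prop) ?_
    filter_upwards [ae_restrict_mem measurableSet_Ioi] with y hy
    have hy : (0 : ℝ) < y := hy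
    have hpos : 0 < (1 + y) ^ (-r) := by positivity
    have hone : (1 + y) ^ (-r) ≤ 1 :=
      Real.rpow_le_one_of_one_le_of_nonpos (by linarith) (by linarith)
    obtain ⟨k, rfl⟩ : ∃ k, d = k + 2 := ⟨d - 2, by omega⟩
    have e1 : k + 2 - 1 = k + 1 := rfl
    rw [e1, Real.norm_of_nonneg (by positivity)]
    simp only [Pi.add_apply, smul_eq_mul]
    have e2 : y ^ (k + 1) * (y⁻¹ * (1 + y) ^ (-r)) = y ^ k * (1 + y) ^ (-r) := by
      field_simp
      ring
    rw [e2]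
    rcases le_total y 1 with h | h
    · rw [indicator_of_mem (show y ∈ Ioc 0 1 from ⟨hy, h⟩)]
      have : y ^ k * (1 + y) ^ (-r) ≤ 1 * 1 := by
        gcongr
        exact pow_le_one₀ hy.le h
      have : 0 ≤ y ^ (k + 1) * (1 + y) ^ (-r) := by positivity
      linarith
    · have h3 : y ^ k * (1 + y) ^ (-r) ≤ y ^ (k + 1) * (1 + y) ^ (-r) := by
        gcongr
        exact k.le_succ
      have h4 : 0 ≤ (Ioc (0 : ℝ) 1).indicator (fun _ => (1 : ℝ)) y :=
        indicator_nonneg (fun _ _ => zero_le_one) _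
      linarith
  exact (integrable_fun_norm_addHaar (E := Rd d) volume
    (f := fun t : ℝ => t⁻¹ * (1 + t) ^ (-r))).mpr (by rwa [finrank_euclideanSpace_fin])

lemma exists_lintegral_kinCore_le (hd : 2 ≤ d) (hr : (d : ℝ) < r) {e : Rd d} (he : ‖e‖ = 1) :
    ∃ C : ℝ, 0 ≤ C ∧ ∀ s : Rd d,
      ∫⁻ p, ENNReal.ofReal (kinCore r e s p) ∂(volume.prod volume) ≤ ENNReal.ofReal C := by
  have hr0 : 0 ≤ r := (Nat.cast_nonneg d).trans hr.le
  have i1 := integrable_inv_norm_mul_decay hd hr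
  have i2 := integrable_decay (d := d) hr
  have i3 := integrable_decay_submodule hr (ℝ ∙ e)ᗮ
  obtain ⟨I1, hI1⟩ : ∃ t, ∫ x : Rd d, ‖x‖⁻¹ * decay r x = t := ⟨_, rfl⟩
  obtain ⟨I2, hI2⟩ : ∃ t, ∫ x : Rd d, decay r x = t := ⟨_, rfl⟩
  obtain ⟨J, hJ⟩ : ∃ t, ∫ z : (ℝ ∙ e)ᗮ, decay r z = t := ⟨_, rfl⟩
  have n1 : 0 ≤ I1 :=
    hI1 ▸ integral_nonneg fun x => mul_nonneg (by positivity) (decay_pos r x).le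
  have n2 : 0 ≤ I2 := hI2 ▸ integral_nonneg fun x => (decay_pos r x).le
  have n3 : 0 ≤ J := hJ ▸ integral_nonneg fun x => (decay_pos r x).le
  refine ⟨(3 * 2 ^ r * I1 + 2 * I2) * J, by positivity, fun s => ?_⟩
  have i2s : Integrable (fun x : Rd d => decay r (s + x)) := i2.comp_add_left s
  have j1 : Integrable (fun x : Rd d => 3 * 2 ^ r * (‖x‖⁻¹ * decay r x)) := i1.const_mul _
  have j2 : Integrable (fun x : Rd d => 2 * decay r (s + x)) := i2s.const_mul 2
  have hg : Integrable (fun x : Rd d =>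
      3 * 2 ^ r * (‖x‖⁻¹ * decay r x) + 2 * decay r (s + x)) := j1.add j2
  have hg0 : ∀ x : Rd d, 0 ≤ 3 * 2 ^ r * (‖x‖⁻¹ * decay r x) + 2 * decay r (s + x) := fun x => by
    have := decay_pos r x
    have := decay_pos r (s + x)
    positivity
  have hgI : ∫ x : Rd d, (3 * 2 ^ r * (‖x‖⁻¹ * decay r x) + 2 * decay r (s + x)) =
      3 * 2 ^ r * I1 + 2 * I2 := by
    rw [integral_add j1 j2, integral_const_mul, integral_const_mul,
      integral_add_left_eq_self (fun x : Rd d => decay r x) s, hI1, hI2]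
  have hin : ∀ x : Rd d, ∫⁻ z : (ℝ ∙ e)ᗮ, ENNReal.ofReal (kinCore r e s (x, z)) ≤
      ENNReal.ofReal (3 * 2 ^ r * (‖x‖⁻¹ * decay r x) + 2 * decay r (s + x)) *
        ENNReal.ofReal J := fun x => by
    calc _ ≤ ∫⁻ z : (ℝ ∙ e)ᗮ,
          ENNReal.ofReal (3 * 2 ^ r * (‖x‖⁻¹ * decay r x) + 2 * decay r (s + x)) *
          ENNReal.ofReal (decay r
            ((ℝ ∙ e)ᗮ.orthogonalProjectionOnto (hyperRefl e x s) + z)) := by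
          refine lintegral_mono fun z => ?_
          rw [← ENNReal.ofReal_mul (hg0 x)]
          exact ENNReal.ofReal_le_ofReal (kinCore_le hr0 he s (x, z))
      _ = _ := by
          rw [lintegral_const_mul' _ _ ENNReal.ofReal_ne_top,
            lintegral_add_left_eq_self (fun z : (ℝ ∙ e)ᗮ => ENNReal.ofReal (decay r z)),
            ← ofReal_integral_eq_lintegral_ofReal i3 (ae_of_all _ fun z => (decay_pos r z).le),
            hJ]
  calc _ ≤ ∫⁻ x : Rd d, ∫⁻ z : (ℝ ∙ e)ᗮ, ENNReal.ofReal (kinCore r e s (x, z)) :=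
        lintegral_prod_le _
    _ ≤ ∫⁻ x : Rd d, ENNReal.ofReal
          (3 * 2 ^ r * (‖x‖⁻¹ * decay r x) + 2 * decay r (s + x)) * ENNReal.ofReal J :=
        lintegral_mono hin
    _ = _ := by
        rw [lintegral_mul_const' _ _ ENNReal.ofReal_ne_top,
          ← ofReal_integral_eq_lintegral_ofReal hg (ae_of_all _ hg0), hgI,
          ← ENNReal.ofReal_mul (by positivity)]

lemma exists_integral_kinCore_le (hd : 2 ≤ d) (hr : (d : ℝ) < r) {e : Rd d} (he : ‖e‖ = 1) :
    ∃ C : ℝ, 0 ≤ C ∧ ∀ s : Rd d, Integrable (kinCore r e s) (volume.prod volume) ∧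
      ∫ p, kinCore r e s p ∂(volume.prod volume) ≤ C := by
  obtain ⟨C, hC, h⟩ := exists_lintegral_kinCore_le hd hr he
  refine ⟨C, hC, fun s => ?_⟩
  have hm := (measurable_kinCore (r := r) e s).aestronglyMeasurable (μ := volume.prod volume)
  have h0 : ∀ p, 0 ≤ kinCore r e s p := kinCore_nonneg e s
  refine ⟨⟨hm, ?_⟩, ?_⟩
  · rw [hasFiniteIntegral_iff_ofReal (ae_of_all _ h0)]
    exact (h s).trans_lt ENNReal.ofReal_lt_top
  · rw [integral_eq_lintegral_of_nonneg_ae (ae_of_all _ h0) hm]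
    exact ENNReal.toReal_le_of_le_ofReal hC (h s)

end Core

section KineticIntegral

variable {d : ℕ} {r : ℝ}

lemma abs_mul_three_sub_le {a₁ a₂ a₃ b₁ b₂ b₃ w₁ w₂ w₃ M D : ℝ} (hM : 0 ≤ M)
    (hw₁ : 0 ≤ w₁) (hw₂ : 0 ≤ w₂)
    (ha₂ : |a₂| ≤ M * w₂) (ha₃ : |a₃| ≤ M * w₃) (hb₁ : |b₁| ≤ M * w₁) (hb₂ : |b₂| ≤ M * w₂)
    (h₁ : |a₁ - b₁| ≤ D * w₁) (h₂ : |a₂ - b₂| ≤ D * w₂) (h₃ : |a₃ - b₃| ≤ D * w₃) :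
    |a₁ * a₂ * a₃ - b₁ * b₂ * b₃| ≤ 3 * M ^ 2 * D * (w₁ * w₂ * w₃) := by
  have e : a₁ * a₂ * a₃ - b₁ * b₂ * b₃ =
      (a₁ - b₁) * a₂ * a₃ + b₁ * (a₂ - b₂) * a₃ + b₁ * b₂ * (a₃ - b₃) := by ring
  have hD₁ : 0 ≤ D * w₁ := (abs_nonneg _).trans h₁
  have hD₂ : 0 ≤ D * w₂ := (abs_nonneg _).trans h₂
  rw [e]
  calc _ ≤ |a₁ - b₁| * |a₂| * |a₃| + |b₁| * |a₂ - b₂| * |a₃| + |b₁| * |b₂| * |a₃ - b₃| := by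
        simp only [← abs_mul]
        exact abs_add_three _ _ _
    _ ≤ (D * w₁) * (M * w₂) * (M * w₃) + (M * w₁) * (D * w₂) * (M * w₃)
        + (M * w₁) * (M * w₂) * (D * w₃) := by gcongr
    _ = _ := by ring

lemma abs_kinIntegrand_sub_le (hr : 0 ≤ r) {y y' : Rd d → ℝ} {M D : ℝ} (hM : 0 ≤ M) (hD : 0 ≤ D)
    (hy : ∀ s, |y s| ≤ M * decay r s) (hy' : ∀ s, |y' s| ≤ M * decay r s)
    (h : ∀ s, |y s - y' s| ≤ D * decay r s) (s x z : Rd d) :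
    |kinIntegrand d y s x z - kinIntegrand d y' s x z| ≤
      3 * (3 ^ r + 1) * M ^ 2 * D * decay r s * (decay r (s + x) * decay r (s + z)
        + decay r (s + z) * decay r (s + x + z) + decay r (s + x) * decay r (s + x + z)) := by
  have w := fun a : Rd d => (decay_pos r a).le
  have key := fun a b c : Rd d => abs_mul_three_sub_le hM (w a) (w b) (hy b) (hy c) (hy' a)
    (hy' b) (h a) (h b) (h c)
  have k1 := key (s + x) (s + z) (s + x + z)
  have k2 := key (s + x) (s + z) s
  have k3 := key (s + z) (s + x + z) s
  have k4 := key (s + x) (s + x + z) s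
  have ht := decay_triple_le (s := s) (a := s + x) (c := s + z) (e := s + x + z) hr (by abel)
  have ht' := mul_le_mul_of_nonneg_left ht (show 0 ≤ 3 * M ^ 2 * D by positivity)
  unfold kinIntegrand
  rw [abs_le] at *
  constructor <;> linarith [k1.1, k1.2, k2.1, k2.2, k3.1, k3.2, k4.1, k4.2]

/-- The wave kinetic integrand with the hyperplanes `x^⊥` parametrised by `e^⊥`. -/
def kinFun (e : Rd d) (y : Rd d → ℝ) (s : Rd d) (p : Rd d × (ℝ ∙ e)ᗮ) : ℝ :=
  ‖p.1‖⁻¹ * kinIntegrand d y s p.1 (hyperRefl e p.1 p.2)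

lemma abs_kinFun_sub_le (hr : 0 ≤ r) (e : Rd d) {y y' : Rd d → ℝ} {M D : ℝ} (hM : 0 ≤ M)
    (hD : 0 ≤ D) (hy : ∀ s, |y s| ≤ M * decay r s) (hy' : ∀ s, |y' s| ≤ M * decay r s)
    (h : ∀ s, |y s - y' s| ≤ D * decay r s) (s : Rd d) (p : Rd d × (ℝ ∙ e)ᗮ) :
    |kinFun e y s p - kinFun e y' s p| ≤
      3 * (3 ^ r + 1) * M ^ 2 * D * decay r s * kinCore r e s p := by
  have hk := abs_kinIntegrand_sub_le hr hM hD hy hy' h s p.1 (hyperRefl e p.1 p.2)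
  have hi : 0 ≤ ‖p.1‖⁻¹ := by positivity
  unfold kinFun kinCore
  rw [← mul_sub, abs_mul, abs_of_nonneg hi]
  exact (mul_le_mul_of_nonneg_left hk hi).trans_eq (by ring)

lemma abs_kinFun_le (hr : 0 ≤ r) (e : Rd d) {y : Rd d → ℝ} {M : ℝ} (hM : 0 ≤ M)
    (hy : ∀ s, |y s| ≤ M * decay r s) (s : Rd d) (p : Rd d × (ℝ ∙ e)ᗮ) :
    |kinFun e y s p| ≤ 3 * (3 ^ r + 1) * M ^ 2 * M * decay r s * kinCore r e s p := by
  have h0 : ∀ s : Rd d, |(fun _ => (0 : ℝ)) s| ≤ M * decay r s := fun s => by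
    simpa using mul_nonneg hM (decay_pos r s).le
  simpa [kinFun, kinIntegrand] using abs_kinFun_sub_le hr e hM hM hy h0 (by simpa using hy) s p

lemma measurable_kinFun (e : Rd d) {y : Rd d → ℝ} (hy : Continuous y) (s : Rd d) :
    Measurable (kinFun e y s) := by
  have hw := hy.measurable
  have hR := measurable_hyperRefl e
  have h1 := hw.comp (measurable_fst.const_add s : Measurable
    (fun p : Rd d × (ℝ ∙ e)ᗮ => s + p.1))
  have h2 := hw.comp (hR.const_add s)
  have h3 := hw.comp ((measurable_fst.const_add s).add hR)
  exact measurable_fst.norm.inv.mul (((((h1.mul h2).mul h3).add ((h1.mul h2).mul_const _)).sub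
    ((h2.mul h3).mul_const _)).sub ((h1.mul h3).mul_const _))

lemma integrable_kinFun (hr : 0 ≤ r) {e : Rd d}
    (hcore : ∀ s : Rd d, Integrable (kinCore r e s) (volume.prod volume))
    {y : Rd d → ℝ} (hc : Continuous y) {M : ℝ} (hM : 0 ≤ M)
    (hy : ∀ s, |y s| ≤ M * decay r s) (s : Rd d) :
    Integrable (kinFun e y s) (volume.prod volume) :=
  ((hcore s).const_mul _).mono' (measurable_kinFun e hc s).aestronglyMeasurable
    (ae_of_all _ fun p => abs_kinFun_le hr e hM hy s p)

lemma Kwk_eq_integral_kinFun {e : Rd d} (he : ‖e‖ = 1) {y : Rd d → ℝ} {s : Rd d}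
    (hfint : Integrable (kinFun e y s) (volume.prod volume)) :
    Kwk d y s = 2 * Real.pi * ∫ p, kinFun e y s p ∂(volume.prod volume) := by
  rw [Kwk, integral_prod _ hfint]
  congr 2
  funext x
  simp only [kinFun]
  rw [integral_const_mul]
  rcases eq_or_ne x 0 with rfl | hx
  · simp
  · rw [hyperplaneIntegral_eq he hx]

lemma continuous_integral_kinFun (hr : 0 ≤ r) {e : Rd d}
    (hcore : ∀ s : Rd d, Integrable (kinCore r e s) (volume.prod volume))
    {y : Rd d → ℝ} (hc : Continuous y) {M : ℝ} (hM : 0 ≤ M)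
    (hy : ∀ s, |y s| ≤ M * decay r s) :
    Continuous (fun s => ∫ p, kinFun e y s p ∂(volume.prod volume)) := by
  rw [continuous_iff_continuousAt]
  intro s₀
  refine continuousAt_of_dominated
    (bound := fun p => 3 * (3 ^ r + 1) * M ^ 2 * M * ((2 ^ r) ^ 2 * kinCore r e s₀ p))
    (Eventually.of_forall fun s => (measurable_kinFun e hc s).aestronglyMeasurable) ?_
    (((hcore s₀).const_mul _).const_mul _) (ae_of_all _ fun p => ?_)
  · filter_upwards [Metric.closedBall_mem_nhds s₀ one_pos] with s hs
    refine ae_of_all _ fun p => ?_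
    have hs : ‖s₀ - s‖ ≤ 1 := by rwa [← dist_eq_norm, dist_comm]
    have hw : ∀ a : Rd d, decay r (s + a) ≤ 2 ^ r * decay r (s₀ + a) := fun a =>
      decay_le_of_dist_le_one hr (by simpa using hs)
    have w := fun a : Rd d => (decay_pos r a).le
    have hcr : kinCore r e s p ≤ (2 ^ r) ^ 2 * kinCore r e s₀ p := by
      obtain ⟨x, z⟩ := p
      have h1 := hw x
      have h2 := hw (hyperRefl e x z)
      have h3 := hw (x + hyperRefl e x z)
      rw [← add_assoc, ← add_assoc] at h3
      have w1 := w (s + x)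
      have w2 := w (s + hyperRefl e x z)
      have w3 := w (s + x + hyperRefl e x z)
      have v1 := w1.trans h1
      have v2 := w2.trans h2
      have v3 := w3.trans h3
      unfold kinCore
      calc _ ≤ ‖x‖⁻¹ * ((2 ^ r * decay r (s₀ + x)) * (2 ^ r * decay r (s₀ + hyperRefl e x z))
              + (2 ^ r * decay r (s₀ + hyperRefl e x z))
                * (2 ^ r * decay r (s₀ + x + hyperRefl e x z))
              + (2 ^ r * decay r (s₀ + x)) * (2 ^ r * decay r (s₀ + x + hyperRefl e x z))) := by
            gcongr
        _ = _ := by ring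
    refine (abs_kinFun_le hr e hM hy s p).trans ?_
    have hd1 := decay_le_one hr s
    have hk := kinCore_nonneg (r := r) e s p
    calc _ ≤ 3 * (3 ^ r + 1) * M ^ 2 * M * 1 * kinCore r e s p := by gcongr
      _ = 3 * (3 ^ r + 1) * M ^ 2 * M * kinCore r e s p := by ring
      _ ≤ _ := by gcongr
  · unfold kinFun kinIntegrand
    exact Continuous.continuousAt (by fun_prop)

/-- The wave kinetic integral is locally Lipschitz in the weighted norm and yields continuous
functions. -/
lemma exists_Kwk_lipschitz (hd : 2 ≤ d) (hr : (d : ℝ) < r) :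
    ∃ L : ℝ, 0 < L ∧
      (∀ y : Rd d → ℝ, Continuous y → ∀ M, 0 ≤ M → (∀ s, |y s| ≤ M * decay r s) →
        Continuous (Kwk d y)) ∧
      ∀ y y' : Rd d → ℝ, Continuous y → Continuous y' → ∀ M D, 0 ≤ M → 0 ≤ D →
        (∀ s, |y s| ≤ M * decay r s) → (∀ s, |y' s| ≤ M * decay r s) →
        (∀ s, |y s - y' s| ≤ D * decay r s) →
        ∀ s, |Kwk d y s - Kwk d y' s| ≤ L * M ^ 2 * D * decay r s := by
  have hr0 : 0 ≤ r := (Nat.cast_nonneg d).trans hr.le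
  obtain ⟨e, he⟩ : ∃ e : Rd d, ‖e‖ = 1 :=
    ⟨EuclideanSpace.single ⟨0, by omega⟩ 1, by simp⟩
  obtain ⟨C, hC, hcore⟩ := exists_integral_kinCore_le hd hr he
  have hfint := fun (y : Rd d → ℝ) hc M hM hy =>
    integrable_kinFun hr0 (fun s => (hcore s).1) (y := y) hc (M := M) hM hy
  refine ⟨2 * Real.pi * (3 * (3 ^ r + 1)) * (C + 1), by positivity, ?_, ?_⟩
  · intro y hc M hM hy
    have : Kwk d y = fun s => 2 * Real.pi * ∫ p, kinFun e y s p ∂(volume.prod volume) :=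
      funext fun s => Kwk_eq_integral_kinFun he (hfint y hc M hM hy s)
    rw [this]
    exact continuous_const.mul
      (continuous_integral_kinFun hr0 (fun s => (hcore s).1) hc hM hy)
  · intro y y' hc hc' M D hM hD hy hy' h s
    have i1 := hfint y hc M hM hy s
    have i2 := hfint y' hc' M hM hy' s
    rw [Kwk_eq_integral_kinFun he i1, Kwk_eq_integral_kinFun he i2, ← mul_sub,
      ← integral_sub i1 i2, abs_mul, abs_of_nonneg Real.two_pi_pos.le]
    have hle : |∫ p, (kinFun e y s p - kinFun e y' s p) ∂(volume.prod volume)| ≤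
        3 * (3 ^ r + 1) * M ^ 2 * D * decay r s * (C + 1) := by
      have hw := decay_pos r s
      rw [← Real.norm_eq_abs]
      refine (norm_integral_le_of_norm_le ((hcore s).1.const_mul _)
        (ae_of_all _ fun p => abs_kinFun_sub_le hr0 e hM hD hy hy' h s p)).trans ?_
      rw [integral_const_mul]
      have := (hcore s).2
      gcongr
      linarith
    exact (mul_le_mul_of_nonneg_left hle Real.two_pi_pos.le).trans_eq (by ring)

end KineticIntegral

section WeightedNorm

variable {d : ℕ} {r : ℝ}

lemma rpow_mul_le_iff {s : Rd d} {a K : ℝ} : (1 + ‖s‖) ^ r * a ≤ K ↔ a ≤ K * decay r s := by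
  have h : 0 < (1 + ‖s‖) ^ r := by positivity
  have e : decay r s = ((1 + ‖s‖) ^ r)⁻¹ :=
    (inv_eq_of_mul_eq_one_right (rpow_mul_decay r s)).symm
  rw [e, ← div_eq_mul_inv, le_div_iff₀ h, mul_comm]

lemma memCr_of_abs_le {y : Rd d → ℝ} (hc : Continuous y) {K : ℝ}
    (h : ∀ s, |y s| ≤ K * decay r s) : memCr d r y :=
  ⟨hc, K, fun s => rpow_mul_le_iff.mpr (h s)⟩

lemma wNorm_nonneg (r : ℝ) (y : Rd d → ℝ) : 0 ≤ wNorm d r y :=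
  Real.iSup_nonneg fun s => by positivity

lemma wNorm_le {y : Rd d → ℝ} {K : ℝ} (h : ∀ s, |y s| ≤ K * decay r s) : wNorm d r y ≤ K :=
  ciSup_le fun s => rpow_mul_le_iff.mpr (h s)

lemma abs_le_wNorm_mul {y : Rd d → ℝ} (h : memCr d r y) (s : Rd d) :
    |y s| ≤ wNorm d r y * decay r s := by
  obtain ⟨-, K, hK⟩ := h
  exact rpow_mul_le_iff.mp (le_ciSup (f := fun s : Rd d => (1 + ‖s‖) ^ r * |y s|)
    ⟨K, by rintro _ ⟨s, rfl⟩; exact hK s⟩ s)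

lemma memCr.sub {y y' : Rd d → ℝ} (h : memCr d r y) (h' : memCr d r y') :
    memCr d r (fun s => y s - y' s) :=
  memCr_of_abs_le (h.1.sub h'.1) (K := wNorm d r y + wNorm d r y') fun s => by
    linarith [abs_sub (y s) (y' s), abs_le_wNorm_mul h s, abs_le_wNorm_mul h' s]

lemma wNorm_sub_le_add {x y z : Rd d → ℝ} (hx : memCr d r x) (hy : memCr d r y)
    (hz : memCr d r z) :
    wNorm d r (fun s => x s - z s) ≤
      wNorm d r (fun s => x s - y s) + wNorm d r (fun s => y s - z s) :=
  wNorm_le fun s => by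
    linarith [abs_sub_le (x s) (y s) (z s), abs_le_wNorm_mul (hx.sub hy) s,
      abs_le_wNorm_mul (hy.sub hz) s]

lemma wNorm_sub_comm (x y : Rd d → ℝ) :
    wNorm d r (fun s => x s - y s) = wNorm d r (fun s => y s - x s) := by
  simp only [wNorm, abs_sub_comm]

/-- A contraction principle on unit balls of the weighted space of continuous functions. -/
lemma exists_fixedPoint_of_contracting (m₀ : Rd d → ℝ) (hm₀ : Continuous m₀)
    (Φ : (Rd d → ℝ) → Rd d → ℝ)
    (hmaps : ∀ y, Continuous y → (∀ s, |y s - m₀ s| ≤ decay r s) →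
      Continuous (Φ y) ∧ ∀ s, |Φ y s - m₀ s| ≤ decay r s)
    (hcontr : ∀ y y', Continuous y → (∀ s, |y s - m₀ s| ≤ decay r s) →
      Continuous y' → (∀ s, |y' s - m₀ s| ≤ decay r s) → ∀ D, 0 ≤ D →
      (∀ s, |y s - y' s| ≤ D * decay r s) → ∀ s, |Φ y s - Φ y' s| ≤ D / 2 * decay r s) :
    ∃ y, Continuous y ∧ (∀ s, |y s - m₀ s| ≤ decay r s) ∧ Φ y = y := by
  let X := BoundedContinuousFunction (Rd d) ℝ
  let S : Set X := Metric.closedBall 0 1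
  have : CompleteSpace S := (Metric.isClosed_closedBall.isComplete).completeSpace_coe
  have : Nonempty S := ⟨⟨0, by simp [S]⟩⟩
  let Y : X → Rd d → ℝ := fun u s => m₀ s + decay r s * u s
  have hYc : ∀ u : X, Continuous (Y u) := fun u =>
    hm₀.add ((continuous_decay r).mul u.continuous)
  have hYb : ∀ u : S, ∀ s, |Y u s - m₀ s| ≤ decay r s := fun u s => by
    have hu : ‖(u : X) s‖ ≤ 1 :=
      ((u : X).norm_coe_le_norm s).trans (mem_closedBall_zero_iff.mp u.2)
    have hw := decay_pos r s
    simp only [Y, add_sub_cancel_left, abs_mul, abs_of_pos hw]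
    exact mul_le_of_le_one_right hw.le hu
  have hpc : Continuous (fun s : Rd d => (1 + ‖s‖) ^ r) :=
    (continuous_const.add continuous_norm).rpow_const
      (fun a => Or.inl (add_pos_of_pos_of_nonneg one_pos (norm_nonneg a)).ne')
  have hpp : ∀ s : Rd d, 0 < (1 + ‖s‖) ^ r := fun s => by positivity
  have hΨb : ∀ u : S, ∀ s, ‖(1 + ‖s‖) ^ r * (Φ (Y u) s - m₀ s)‖ ≤ 1 := fun u s => by
    rw [norm_mul, Real.norm_of_nonneg (hpp s).le, Real.norm_eq_abs, rpow_mul_le_iff, one_mul]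
    exact (hmaps _ (hYc u) (hYb u)).2 s
  let Ψ₀ : S → X := fun u => BoundedContinuousFunction.ofNormedAddCommGroup
    (fun s => (1 + ‖s‖) ^ r * (Φ (Y u) s - m₀ s))
    (hpc.mul ((hmaps _ (hYc u) (hYb u)).1.sub hm₀)) 1 (hΨb u)
  let Ψ : S → S := fun u => ⟨Ψ₀ u, mem_closedBall_zero_iff.mpr
    (BoundedContinuousFunction.norm_ofNormedAddCommGroup_le _ zero_le_one (hΨb u))⟩
  have hΨ : ContractingWith (1 / 2) Ψ := by
    refine ⟨by norm_num [← NNReal.coe_lt_coe], LipschitzWith.of_dist_le_mul fun u v => ?_⟩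
    rw [Subtype.dist_eq, Subtype.dist_eq]
    refine (BoundedContinuousFunction.dist_le (by positivity)).mpr fun s => ?_
    have hD : ∀ s, |Y u s - Y v s| ≤ dist (u : X) v * decay r s := fun s => by
      have h1 := BoundedContinuousFunction.dist_coe_le_dist (f := (u : X)) (g := v) s
      have hw := decay_pos r s
      rw [Real.dist_eq] at h1
      simp only [Y, add_sub_add_left_eq_sub, ← mul_sub, abs_mul, abs_of_pos hw]
      rw [mul_comm]
      gcongr
    have := hcontr _ _ (hYc u) (hYb u) (hYc v) (hYb v) _ dist_nonneg hD s
    change |(1 + ‖s‖) ^ r * (Φ (Y u) s - m₀ s) - (1 + ‖s‖) ^ r * (Φ (Y v) s - m₀ s)| ≤ _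
    rw [← mul_sub, abs_mul, abs_of_pos (hpp s), rpow_mul_le_iff, sub_sub_sub_cancel_right]
    refine this.trans_eq ?_
    push_cast
    ring
  obtain ⟨u, hu⟩ : ∃ u, Ψ u = u := ⟨_, hΨ.fixedPoint_isFixedPt⟩
  refine ⟨Y u, hYc u, hYb u, funext fun s => ?_⟩
  have hs : (1 + ‖s‖) ^ r * (Φ (Y u) s - m₀ s) = (u : X) s :=
    congrArg (fun v : S => (v : X) s) hu
  change _ = m₀ s + decay r s * (u : X) s
  rw [← hs, ← mul_assoc, mul_comm (decay r s), rpow_mul_decay]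
  ring

end WeightedNorm

section Relaxation

/-- Relaxation estimate for the scalar mild equation. -/
lemma abs_duhamel_sub_le {γ ε β k μ Q T τ : ℝ} {g : ℝ → ℝ} (hγ : 1 ≤ γ) (hτ : -T ≤ τ)
    (hg : ContinuousOn g (Icc (-T) τ)) (hμ : 2 * γ * μ = β + ε * k) (hQ : 0 ≤ Q)
    (hgQ : ∀ l ∈ Icc (-T) τ, |ε * (g l - k)| ≤ Q * Real.exp (-(l + T))) :
    |(∫ l in Icc (-T) τ, Real.exp (-2 * γ * (τ - l)) * (β + ε * g l)) - μ| ≤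
      Real.exp (-(τ + T)) * (|μ| + Q) := by
  have hexp : ∀ c : ℝ, ∫ l in (-T)..τ, Real.exp (c * (τ - l)) * (-c) =
      1 - Real.exp (c * (τ + T)) := fun c => by
    have hder : ∀ l ∈ uIcc (-T) τ, HasDerivAt (fun l => Real.exp (c * (τ - l)))
        (Real.exp (c * (τ - l)) * (-c)) l := fun l _ => by
      have h := (((hasDerivAt_id l).const_sub τ).const_mul c).exp
      simpa using h
    rw [intervalIntegral.integral_eq_sub_of_hasDerivAt hder
      (Continuous.intervalIntegrable (by fun_prop) _ _)]
    simp
  have hi1 : IntervalIntegrable (fun l => Real.exp (-2 * γ * (τ - l)) * (ε * (g l - k)))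
      volume (-T) τ := by
    apply ContinuousOn.intervalIntegrable
    rw [uIcc_of_le hτ]
    fun_prop
  have hi2 : IntervalIntegrable (fun l => μ * (Real.exp (-2 * γ * (τ - l)) * -(-2 * γ)))
      volume (-T) τ := Continuous.intervalIntegrable (by fun_prop) _ _
  have hsplit : (∫ l in Icc (-T) τ, Real.exp (-2 * γ * (τ - l)) * (β + ε * g l)) - μ =
      (∫ l in (-T)..τ, Real.exp (-2 * γ * (τ - l)) * (ε * (g l - k)))
        - Real.exp (-2 * γ * (τ + T)) * μ := by
    rw [integral_Icc_eq_integral_Ioc, ← intervalIntegral.integral_of_le hτ]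
    have : ∀ l, Real.exp (-2 * γ * (τ - l)) * (β + ε * g l) =
        Real.exp (-2 * γ * (τ - l)) * (ε * (g l - k))
          + μ * (Real.exp (-2 * γ * (τ - l)) * -(-2 * γ)) := fun l => by
      linear_combination (-Real.exp (-2 * γ * (τ - l))) * hμ
    simp_rw [this]
    rw [intervalIntegral.integral_add hi1 hi2, intervalIntegral.integral_const_mul, hexp]
    ring
  have hfint : |∫ l in (-T)..τ, Real.exp (-2 * γ * (τ - l)) * (ε * (g l - k))| ≤
      Q * Real.exp (-(τ + T)) := by
    have hle : ∀ l ∈ Ioc (-T) τ, ‖Real.exp (-2 * γ * (τ - l)) * (ε * (g l - k))‖ ≤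
        Q * Real.exp (-(τ + T)) * (Real.exp (-1 * (τ - l)) * -(-1)) := fun l hl => by
      rw [norm_mul, Real.norm_of_nonneg (Real.exp_pos _).le, Real.norm_eq_abs]
      calc _ ≤ Real.exp (-2 * γ * (τ - l)) * (Q * Real.exp (-(l + T))) := by
            gcongr
            exact hgQ l (Ioc_subset_Icc_self hl)
        _ = Q * Real.exp (-2 * γ * (τ - l) + -(l + T)) := by rw [Real.exp_add]; ring
        _ ≤ Q * Real.exp (-(τ + T) + -1 * (τ - l)) := by
            refine mul_le_mul_of_nonneg_left (Real.exp_le_exp.mpr ?_) hQ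
            linarith [mul_nonneg (sub_nonneg.mpr hγ) (sub_nonneg.mpr hl.2)]
        _ = _ := by rw [Real.exp_add]; ring
    rw [← Real.norm_eq_abs]
    refine (intervalIntegral.norm_integral_le_of_norm_le hτ (ae_of_all _ hle)
      (Continuous.intervalIntegrable (by fun_prop) _ _)).trans ?_
    rw [intervalIntegral.integral_const_mul, hexp]
    have h1 := Real.exp_pos (-1 * (τ + T))
    have h2 : 0 ≤ Q * Real.exp (-(τ + T)) := by positivity
    nlinarith
  have hdec : Real.exp (-2 * γ * (τ + T)) * |μ| ≤ Real.exp (-(τ + T)) * |μ| := by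
    gcongr
    nlinarith
  rw [hsplit]
  refine (abs_sub _ _).trans ?_
  rw [abs_mul (Real.exp _), abs_of_pos (Real.exp_pos _)]
  linarith

variable {d : ℕ} {r rstar : ℝ}

lemma one_le_gam (hrstar : 0 ≤ rstar) (s : Rd d) : 1 ≤ gam d rstar s :=
  Real.one_le_rpow (by nlinarith [sq_nonneg ‖s‖]) hrstar

lemma continuous_gam (d : ℕ) (rstar : ℝ) : Continuous (gam d rstar) := by
  unfold gam
  exact Continuous.rpow_const (by fun_prop) (fun s => Or.inl (by positivity))

lemma isSteadyState_iff (hrstar : 0 ≤ rstar) {b : Rd d → ℝ} {ε : ℝ} {y : Rd d → ℝ} :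
    IsSteadyState d r rstar b ε y ↔
      memCr d r y ∧ ∀ s, y s = (b s ^ 2 + ε / 2 * Kwk d y s) / gam d rstar s := by
  refine and_congr_right fun _ => forall_congr' fun s => ?_
  have := one_le_gam hrstar s
  rw [eq_div_iff (by positivity)]
  constructor <;> intro h <;> linarith

/-- Any solution with zero data stays close to, and converges exponentially to, a steady state
which is small compared with the inverse square root of the coupling. -/
lemma wNorm_sub_le_of_isWKESol (hrstar : 0 ≤ rstar) {b : Rd d → ℝ} {L B ε T : ℝ}
    (hL : 0 ≤ L) (hB : 0 < B) (hε : 0 ≤ ε) (hsmall : ε * (L * (4 * B) ^ 2) ≤ 1 / 2)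
    (hK : ∀ y y' : Rd d → ℝ, Continuous y → Continuous y' → ∀ M D, 0 ≤ M → 0 ≤ D →
        (∀ s, |y s| ≤ M * decay r s) → (∀ s, |y' s| ≤ M * decay r s) →
        (∀ s, |y s - y' s| ≤ D * decay r s) →
        ∀ s, |Kwk d y s - Kwk d y' s| ≤ L * M ^ 2 * D * decay r s)
    {y : Rd d → ℝ} (hy : IsSteadyState d r rstar b ε y) (hyB : wNorm d r y ≤ B)
    {m : ℝ → Rd d → ℝ} (hm : IsWKESol d r rstar b T ε m) {τ : ℝ} (hτ : τ ∈ Ici (-T)) :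
    wNorm d r (fun s => m τ s - y s) ≤ 2 * wNorm d r y * Real.exp (-(τ + T)) := by
  obtain ⟨hmem, ⟨K, hKb⟩, hcont, hmild⟩ := hm
  obtain ⟨hyC, hyS⟩ := hy
  set A := wNorm d r y
  have hA : 0 ≤ A := wNorm_nonneg r y
  set n : ℝ → ℝ := fun τ => wNorm d r (fun s => m τ s - y s) with hn
  have hn0 : ∀ τ, 0 ≤ n τ := fun τ => wNorm_nonneg r _
  have hnb : ∀ τ ∈ Ici (-T), ∀ s, |m τ s - y s| ≤ n τ * decay r s := fun τ hτ s =>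
    abs_le_wNorm_mul ((hmem τ hτ).sub hyC) s
  have hncont : ContinuousOn n (Ici (-T)) := by
    rw [Metric.continuousOn_iff]
    intro τ₀ hτ₀ δ hδ
    obtain ⟨η, hη, h⟩ := hcont τ₀ hτ₀ δ hδ
    refine ⟨η, hη, fun τ hτ hd => lt_of_le_of_lt ?_ (h τ hτ hd)⟩
    have h1 := wNorm_sub_le_add (hmem τ hτ) (hmem τ₀ hτ₀) hyC
    have h2 := wNorm_sub_le_add (hmem τ₀ hτ₀) (hmem τ hτ) hyC
    rw [wNorm_sub_comm (m τ₀) (m τ)] at h2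
    rw [Real.dist_eq, abs_le]
    simp only [hn]
    constructor <;> linarith
  have hgcont : ∀ s, ContinuousOn (fun l => Kwk d (m l) s) (Ici (-T)) := by
    intro s
    rw [Metric.continuousOn_iff]
    intro τ₀ hτ₀ δ hδ
    set c := L * (max K 0) ^ 2 * decay r s with hc
    have hc0 : 0 ≤ c := mul_nonneg (by positivity) (decay_pos r s).le
    obtain ⟨η, hη, h⟩ := hcont τ₀ hτ₀ (δ / (c + 1)) (by positivity)
    refine ⟨η, hη, fun τ hτ hd => ?_⟩
    have hlt := h τ hτ hd
    rw [lt_div_iff₀ (by positivity)] at hlt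
    have hbd : ∀ τ ∈ Ici (-T), ∀ s, |m τ s| ≤ max K 0 * decay r s := fun τ hτ s =>
      (abs_le_wNorm_mul (hmem τ hτ) s).trans (mul_le_mul_of_nonneg_right
        ((hKb τ hτ).trans (le_max_left _ _)) (decay_pos r s).le)
    have := hK _ _ (hmem τ hτ).1 (hmem τ₀ hτ₀).1 _ _ (le_max_right K 0) (wNorm_nonneg r _)
      (hbd τ hτ) (hbd τ₀ hτ₀) (abs_le_wNorm_mul ((hmem τ hτ).sub (hmem τ₀ hτ₀))) s
    rw [Real.dist_eq]
    have h0 := wNorm_nonneg r (fun s => m τ s - m τ₀ s)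
    calc _ ≤ c * wNorm d r (fun s => m τ s - m τ₀ s) := this.trans_eq (by rw [hc]; ring)
      _ < δ := by nlinarith
  have step : ∀ τ₁ ∈ Ici (-T), (∀ τ ∈ Icc (-T) τ₁, n τ ≤ 3 * B) →
      ∀ τ ∈ Icc (-T) τ₁, n τ ≤ 2 * A * Real.exp (-(τ + T)) := by
    intro τ₁ hτ₁ hbd
    obtain ⟨l₀, hl₀, hmax⟩ := isCompact_Icc.exists_isMaxOn
      (f := fun l => Real.exp (l + T) * n l) (nonempty_Icc.mpr hτ₁)
      (ContinuousOn.mul (by fun_prop) (hncont.mono Icc_subset_Ici_self))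
    obtain ⟨S, hS⟩ : ∃ S, Real.exp (l₀ + T) * n l₀ = S := ⟨_, rfl⟩
    have hS0 : 0 ≤ S := hS ▸ mul_nonneg (Real.exp_pos _).le (hn0 _)
    have hnS : ∀ l ∈ Icc (-T) τ₁, n l ≤ Real.exp (-(l + T)) * S := fun l hl => by
      have h1 : Real.exp (l + T) * n l ≤ S := hS ▸ hmax hl
      rw [Real.exp_neg, inv_mul_eq_div, le_div_iff₀ (Real.exp_pos _)]
      linarith
    have hest : ∀ τ ∈ Icc (-T) τ₁, n τ ≤ Real.exp (-(τ + T)) * (A + S / 2) := by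
      intro τ hτ
      refine wNorm_le fun s => ?_
      have hw := decay_pos r s
      rw [hmild τ hτ.1 s]
      have hys := abs_le_wNorm_mul hyC s
      refine (abs_duhamel_sub_le (k := Kwk d y s) (μ := y s) (Q := S / 2 * decay r s)
        (one_le_gam hrstar s) hτ.1 ((hgcont s).mono Icc_subset_Ici_self)
        (by linarith [hyS s]) (by positivity) fun l hl => ?_).trans ?_
      · have hl1 : l ∈ Icc (-T) τ₁ := ⟨hl.1, hl.2.trans hτ.2⟩
        have hyM : ∀ s, |y s| ≤ 4 * B * decay r s := fun s =>
          (abs_le_wNorm_mul hyC s).trans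
            (mul_le_mul_of_nonneg_right (by linarith) (decay_pos r s).le)
        have hmM : ∀ s, |m l s| ≤ 4 * B * decay r s := fun s => by
          have h1 := hnb l hl.1 s
          have h2 := abs_le_wNorm_mul hyC s
          have h3 := abs_add_le (m l s - y s) (y s)
          rw [sub_add_cancel] at h3
          have h4 : (n l + A) * decay r s ≤ (4 * B) * decay r s :=
            mul_le_mul_of_nonneg_right (by linarith [hbd l hl1]) (decay_pos r s).le
          linarith
        have := hK _ _ (hmem l hl.1).1 hyC.1 (4 * B) (n l) (by positivity) (hn0 l) hmM hyM
          (hnb l hl.1) s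
        rw [abs_mul, abs_of_nonneg hε]
        calc _ ≤ ε * (L * (4 * B) ^ 2 * n l * decay r s) := by gcongr
          _ = (ε * (L * (4 * B) ^ 2)) * (n l * decay r s) := by ring
          _ ≤ 1 / 2 * (Real.exp (-(l + T)) * S * decay r s) := by
              have := hnS l hl1
              have := hn0 l
              gcongr
          _ = _ := by ring
      · calc _ ≤ Real.exp (-(τ + T)) * (A * decay r s + S / 2 * decay r s) := by gcongr
          _ = _ := by ring
    have hSA : S ≤ 2 * A := by
      have h1 := mul_le_mul_of_nonneg_left (hest l₀ hl₀) (Real.exp_pos (l₀ + T)).le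
      rw [hS, ← mul_assoc, ← Real.exp_add, add_neg_cancel, Real.exp_zero, one_mul] at h1
      linarith
    intro τ hτ
    have := mul_le_mul_of_nonneg_left hSA (Real.exp_pos (-(τ + T))).le
    linarith [hnS τ hτ]
  have hbound : ∀ τ ∈ Ici (-T), n τ < 3 * B := by
    intro τ hτ
    by_contra! hge
    have hstart : n (-T) < 3 * B := by
      have h0 : n (-T) ≤ A := wNorm_le fun s => by
        rw [hmild (-T) self_mem_Ici s]
        simpa using abs_le_wNorm_mul hyC s
      linarith
    have hcl : IsCompact (Icc (-T) τ ∩ n ⁻¹' Ici (3 * B)) :=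
      isCompact_Icc.of_isClosed_subset
        ((hncont.mono Icc_subset_Ici_self).preimage_isClosed_of_isClosed isClosed_Icc isClosed_Ici)
        inter_subset_left
    obtain ⟨t₀, ⟨ht₀, hnt₀⟩, hleast⟩ := hcl.exists_isLeast ⟨τ, ⟨hτ, le_rfl⟩, hge⟩
    obtain ⟨t, ht, hnt⟩ := intermediate_value_Icc ht₀.1
      (hncont.mono Icc_subset_Ici_self) ⟨hstart.le, hnt₀⟩
    have htt : t = t₀ := le_antisymm ht.2
      (hleast ⟨⟨ht.1, ht.2.trans ht₀.2⟩, hnt.ge⟩)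
    have hpre : ∀ l ∈ Icc (-T) t₀, n l ≤ 3 * B := fun l hl => by
      by_contra! hlt
      have : l = t₀ := le_antisymm hl.2 (hleast ⟨⟨hl.1, hl.2.trans ht₀.2⟩, hlt.le⟩)
      rw [this, ← htt, hnt] at hlt
      exact lt_irrefl _ hlt
    have h1 := step t₀ ht₀.1 hpre t₀ ⟨ht₀.1, le_rfl⟩
    have h2 : Real.exp (-(t₀ + T)) ≤ 1 := Real.exp_le_one_iff.mpr (by linarith [ht₀.1])
    rw [← htt, hnt, htt] at h1
    nlinarith
  exact step τ hτ (fun l hl => (hbound l hl.1).le) τ ⟨hτ, le_rfl⟩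

end Relaxation

lemma exists_abs_schwartz_le {d : ℕ} (r : ℝ) (b : SchwartzMap (Rd d) ℝ) :
    ∃ C : ℝ, 0 ≤ C ∧ ∀ s, |b s| ≤ C * decay r s := by
  obtain ⟨k, hk⟩ := exists_nat_ge r
  refine ⟨2 ^ k * ((Finset.Iic (k, 0)).sup fun m => SchwartzMap.seminorm ℝ m.1 m.2) b,
    by positivity, fun s => ?_⟩
  have h := SchwartzMap.one_add_le_sup_seminorm_apply (𝕜 := ℝ) (m := (k, 0)) le_rfl le_rfl b s
  rw [norm_iteratedFDeriv_zero, Real.norm_eq_abs] at h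
  refine rpow_mul_le_iff.mp (le_trans ?_ h)
  gcongr
  rw [← Real.rpow_natCast]
  exact Real.rpow_le_rpow_of_exponent_le (by linarith [norm_nonneg s]) hk

/-- For `d ≥ 2`, `r > d` there exist `ε_* > 0` and `C > 0`, independent of
`T`, such that for every `ε ∈ [0, ε_*]` the equation has a unique steady state `m^ε` near
`m⁰(s) = b(s)²/γ_s`, and for every `T ∈ (0,∞)` the solution `m*` of the damped/driven wave
kinetic equation with zero data at `τ = −T` converges to it exponentially:
`‖m*(τ) − m^ε‖_r ≤ C ‖m^ε‖_r e^{−(τ+T)}` for all `τ ≥ −T`. -/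
theorem statement10 (d : ℕ) (hd : 2 ≤ d) (r : ℝ) (hr : (d : ℝ) < r)
    (rstar : ℝ) (hrstar : 0 < rstar)
    (b : SchwartzMap (Rd d) ℝ) (hb : ∀ s, 0 < b s) :
    ∃ εstar : ℝ, 0 < εstar ∧ ∃ δ : ℝ, 0 < δ ∧ ∃ C : ℝ, 0 < C ∧
      ∀ ε ∈ Set.Icc (0 : ℝ) εstar,
        ∃ meps : Rd d → ℝ,
          (IsSteadyState d r rstar (⇑b) ε meps ∧
            wNorm d r (fun s => meps s - (b s) ^ 2 / gam d rstar s) ≤ δ) ∧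
          (∀ y' : Rd d → ℝ, IsSteadyState d r rstar (⇑b) ε y' →
            wNorm d r (fun s => y' s - (b s) ^ 2 / gam d rstar s) ≤ δ →
            ∀ s : Rd d, y' s = meps s) ∧
          (∀ T : ℝ, 0 < T → ∀ m : ℝ → Rd d → ℝ, IsWKESol d r rstar (⇑b) T ε m →
            ∀ τ ∈ Set.Ici (-T),
              wNorm d r (fun s => m τ s - meps s)
                ≤ C * wNorm d r meps * Real.exp (-(τ + T))) := by
  have hr0 : 0 ≤ r := (Nat.cast_nonneg d).trans hr.le
  obtain ⟨L, hL, hKc, hK⟩ := exists_Kwk_lipschitz hd hr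
  obtain ⟨C₁, hC₁, hbC⟩ := exists_abs_schwartz_le r b
  have hγ := fun s : Rd d => one_le_gam hrstar.le s
  have hw := fun s : Rd d => decay_pos r s
  set m₀ : Rd d → ℝ := fun s => (b s) ^ 2 / gam d rstar s with hm₀
  have hm₀c : Continuous m₀ :=
    (b.continuous.pow 2).div (continuous_gam d rstar) fun s => by linarith [hγ s]
  have hm₀b : ∀ s, |m₀ s| ≤ C₁ ^ 2 * decay r s := fun s => by
    rw [hm₀, abs_div, abs_of_pos (zero_lt_one.trans_le (hγ s)), abs_pow]
    calc |b s| ^ 2 / gam d rstar s ≤ |b s| ^ 2 := div_le_self (by positivity) (hγ s)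
      _ ≤ (C₁ * decay r s) ^ 2 := by gcongr; exact hbC s
      _ = C₁ ^ 2 * (decay r s * decay r s) := by ring
      _ ≤ C₁ ^ 2 * (1 * decay r s) := by
          have := hw s
          gcongr
          exact decay_le_one hr0 s
      _ = _ := by ring
  obtain ⟨B, hB⟩ : ∃ B, C₁ ^ 2 + 1 = B := ⟨_, rfl⟩
  have hB1 : 1 ≤ B := by nlinarith
  have hball : ∀ y : Rd d → ℝ, (∀ s, |y s - m₀ s| ≤ decay r s) → ∀ s, |y s| ≤ B * decay r s := by
    intro y hy s
    have h := abs_add_le (y s - m₀ s) (m₀ s)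
    rw [sub_add_cancel] at h
    rw [← hB]
    linarith [hy s, hm₀b s]
  refine ⟨1 / (32 * L * B ^ 3), by positivity, 1, one_pos, 2, two_pos, fun ε ⟨hε0, hε⟩ => ?_⟩
  rw [le_div_iff₀ (by positivity)] at hε
  have hε3 : ε / 2 * (L * B ^ 2 * B) ≤ 1 := by
    have : 0 ≤ ε * L * B ^ 3 := by positivity
    linarith
  have hε2 : ε * (L * (4 * B) ^ 2) ≤ 1 / 2 := by
    have : ε * L * B ^ 2 * 1 ≤ ε * L * B ^ 2 * B := by gcongr
    linarith
  have hε1 : ε / 2 * (L * B ^ 2) ≤ 1 / 2 := by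
    have : 0 ≤ ε * (L * B ^ 2) := by positivity
    linarith
  have hcontr : ∀ y y' : Rd d → ℝ, Continuous y → (∀ s, |y s - m₀ s| ≤ decay r s) →
      Continuous y' → (∀ s, |y' s - m₀ s| ≤ decay r s) → ∀ D, 0 ≤ D →
      (∀ s, |y s - y' s| ≤ D * decay r s) → ∀ s,
      |((b s) ^ 2 + ε / 2 * Kwk d y s) / gam d rstar s
        - ((b s) ^ 2 + ε / 2 * Kwk d y' s) / gam d rstar s| ≤ D / 2 * decay r s := by
    intro y y' hy hym hy' hym' D hD h s
    have hk := hK y y' hy hy' B D (by positivity) hD (hball y hym) (hball y' hym') h s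
    have hws := hw s
    rw [← sub_div, add_sub_add_left_eq_sub, ← mul_sub, abs_div,
      abs_of_pos (zero_lt_one.trans_le (hγ s)), abs_mul, abs_of_nonneg (by positivity : 0 ≤ ε / 2)]
    calc _ ≤ ε / 2 * |Kwk d y s - Kwk d y' s| := div_le_self (by positivity) (hγ s)
      _ ≤ ε / 2 * (L * B ^ 2 * D * decay r s) := by gcongr
      _ = ε / 2 * (L * B ^ 2) * (D * decay r s) := by ring
      _ ≤ 1 / 2 * (D * decay r s) := by gcongr
      _ = _ := by ring
  have hmaps : ∀ y : Rd d → ℝ, Continuous y → (∀ s, |y s - m₀ s| ≤ decay r s) →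
      Continuous (fun s => ((b s) ^ 2 + ε / 2 * Kwk d y s) / gam d rstar s) ∧
      ∀ s, |((b s) ^ 2 + ε / 2 * Kwk d y s) / gam d rstar s - m₀ s| ≤ decay r s := by
    intro y hy hym
    have hyB := hball y hym
    refine ⟨((b.continuous.pow 2).add (continuous_const.mul (hKc y hy B (by positivity) hyB))).div
      (continuous_gam d rstar) fun s => by linarith [hγ s], fun s => ?_⟩
    have hws := hw s
    have hk := hK y (fun _ => 0) hy continuous_const B B (by positivity) (by positivity) hyB
      (fun s => by simpa using (mul_nonneg (by positivity) (hw s).le)) (by simpa using hyB) s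
    have hk0 : Kwk d (fun _ => 0) s = 0 := by simp [Kwk, kinIntegrand, hyperplaneIntegral]
    rw [hk0, sub_zero] at hk
    rw [hm₀, ← sub_div, add_sub_cancel_left, abs_div,
      abs_of_pos (zero_lt_one.trans_le (hγ s)), abs_mul, abs_of_nonneg (by positivity : 0 ≤ ε / 2)]
    calc _ ≤ ε / 2 * |Kwk d y s| := div_le_self (by positivity) (hγ s)
      _ ≤ ε / 2 * (L * B ^ 2 * B * decay r s) := by gcongr
      _ = ε / 2 * (L * B ^ 2 * B) * decay r s := by ring
      _ ≤ 1 * decay r s := by gcongr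
      _ = _ := one_mul _
  obtain ⟨y, hyc, hym, hfix⟩ := exists_fixedPoint_of_contracting (r := r) m₀ hm₀c
    (fun y s => ((b s) ^ 2 + ε / 2 * Kwk d y s) / gam d rstar s) hmaps hcontr
  have hyB := hball y hym
  have hymem := memCr_of_abs_le hyc hyB
  have hyS : IsSteadyState d r rstar b ε y :=
    (isSteadyState_iff hrstar.le).mpr ⟨hymem, fun s => (congrFun hfix s).symm⟩
  refine ⟨y, ⟨hyS, wNorm_le fun s => by simpa using hym s⟩, fun y' hy' hy'1 => ?_, ?_⟩
  · obtain ⟨hy'mem, hy'fix⟩ := (isSteadyState_iff hrstar.le).mp hy'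
    have hm₀mem : memCr d r m₀ := memCr_of_abs_le hm₀c hm₀b
    have hy'm : ∀ s, |y' s - m₀ s| ≤ decay r s := fun s =>
      (abs_le_wNorm_mul (hy'mem.sub hm₀mem) s).trans
        (mul_le_of_le_one_left (hw s).le hy'1)
    have hD := wNorm_nonneg r (fun s => y' s - y s)
    have hdiff := abs_le_wNorm_mul (hy'mem.sub hymem)
    have hhalf : wNorm d r (fun s => y' s - y s) ≤ wNorm d r (fun s => y' s - y s) / 2 :=
      wNorm_le fun s => by
        have := hcontr y' y hy'mem.1 hy'm hyc hym _ hD hdiff s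
        rwa [← hy'fix s, congrFun hfix s] at this
    intro s
    have hs := hdiff s
    rw [show wNorm d r (fun s => y' s - y s) = 0 by linarith, zero_mul] at hs
    exact sub_eq_zero.mp (abs_nonpos_iff.mp hs)
  · intro T _ m hm τ hτ
    exact wNorm_sub_le_of_isWKESol hrstar.le hL.le (by positivity) hε0 hε2 hK hyS
      (wNorm_le hyB) hm hτ
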